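/- arXiv:2403.05041 — 6 statements merged into one kernel-verified Lean document; each statement's English description precedes it below -/
import Mathlib

section
/- Let X and U be finite nonempty types, let μ be a probability distribution on X, let ρ be a probability distribution on X × X, and let H be a probability distribution over functions h : X → U. Suppose that (i) for every Boolean function f : X → {0,1} one has Pr_{x,y ~ μ⊗μ}[f(x) = f(y)] + Pr_{(x,y) ~ ρ}[f(x) ≠ f(y)] ≥ 1 − η for some η ≥ 0; (ii) Pr_{h ~ H, (x,y) ~ ρ}[h(x) = h(y)] ≥ p1; and (iii) Pr_{h ~ H, x,y ~ μ⊗μ}[h(x) = h(y)] ≤ p2. Then p1 − p2 ≤ 2η. -/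
lemma color_ne_sum {U : Type*} [Fintype U] [DecidableEq U] (u v : U) :
    ∑ c : U → Bool, (if c u ≠ c v then (1:ℝ) else 0) =
      (Fintype.card (U → Bool) : ℝ) * (1 - (if u = v then (1:ℝ) else 0)) / 2 := by
  by_cases h : u = v
  · subst h; simp
  · have hinv : Function.Involutive (fun c : U → Bool => Function.update c u (!c u)) := by
      intro c
      ext i
      by_cases hi : i = u
      · subst hi; simp
      · simp [hi]
    have h1 : ∑ c : U → Bool, (if c u ≠ c v then (1:ℝ) else 0) =
        ∑ c : U → Bool, (if c u = c v then (1:ℝ) else 0) := by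
      refine Fintype.sum_equiv hinv.toPerm _ _ ?_
      intro c
      have hvu : v ≠ u := fun e => h e.symm
      simp only [Function.Involutive.coe_toPerm, Function.update_self,
        Function.update_of_ne hvu]
      cases c u <;> cases c v <;> simp
    have h2 : ∑ c : U → Bool, (if c u ≠ c v then (1:ℝ) else 0) +
        ∑ c : U → Bool, (if c u = c v then (1:ℝ) else 0) =
        (Fintype.card (U → Bool) : ℝ) := by
      rw [← Finset.sum_add_distrib]
      have : ∀ c : U → Bool, ((if c u ≠ c v then (1:ℝ) else 0) +
          (if c u = c v then (1:ℝ) else 0)) = 1 := by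
        intro c; by_cases hc : c u = c v <;> simp [hc]
      simp only [this]
      simp
    rw [if_neg h]
    linarith

lemma color_eq_sum {U : Type*} [Fintype U] [DecidableEq U] (u v : U) :
    ∑ c : U → Bool, (if c u = c v then (1:ℝ) else 0) =
      (Fintype.card (U → Bool) : ℝ) * (1 + (if u = v then (1:ℝ) else 0)) / 2 := by
  have h := color_ne_sum u v
  have e : ∀ c : U → Bool, (if c u = c v then (1:ℝ) else 0) =
      1 - (if c u ≠ c v then (1:ℝ) else 0) := by
    intro c; by_cases hc : c u = c v <;> simp [hc]
  simp only [e]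
  rw [Finset.sum_sub_distrib, h]
  simp only [Finset.sum_const, Finset.card_univ, nsmul_eq_mul]
  ring

/-- From a hash family colliding `ρ`-pairs with probability ≥ p₁ and
colliding independent `μ`-pairs with probability ≤ p₂, together with the
indistinguishability bound for every Boolean function, deduce `p₁ - p₂ ≤ 2η`. -/
theorem stmt_0 {X U : Type*} [Fintype X] [Nonempty X] [DecidableEq X]
    [Fintype U] [Nonempty U] [DecidableEq U]
    (μ : X → ℝ) (hμ0 : ∀ x, 0 ≤ μ x) (hμ1 : ∑ x, μ x = 1)
    (ρ : X × X → ℝ) (hρ0 : ∀ p, 0 ≤ ρ p) (hρ1 : ∑ p, ρ p = 1)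
    (H : (X → U) → ℝ) (hH0 : ∀ h, 0 ≤ H h) (hH1 : ∑ h, H h = 1)
    (η p1 p2 : ℝ) (hη : 0 ≤ η)
    (hfun : ∀ f : X → Bool,
      1 - η ≤ (∑ x, ∑ y, μ x * μ y * (if f x = f y then (1:ℝ) else 0)) +
        (∑ p : X × X, ρ p * (if f p.1 ≠ f p.2 then (1:ℝ) else 0)))
    (hclose : p1 ≤ ∑ h : X → U, ∑ p : X × X,
        H h * ρ p * (if h p.1 = h p.2 then (1:ℝ) else 0))
    (hfar : (∑ h : X → U, ∑ x, ∑ y,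
        H h * μ x * μ y * (if h x = h y then (1:ℝ) else 0)) ≤ p2) :
    p1 - p2 ≤ 2 * η := by
  have key : ∀ h : X → U, (∑ p : X × X, ρ p * (if h p.1 = h p.2 then (1:ℝ) else 0)) -
      (∑ x, ∑ y, μ x * μ y * (if h x = h y then (1:ℝ) else 0)) ≤ 2 * η := by
    intro h
    set N : ℝ := (Fintype.card (U → Bool) : ℝ) with hN
    have hNpos : 0 < N := by
      rw [hN]; exact_mod_cast Fintype.card_pos
    have hs := Finset.sum_le_sum (s := Finset.univ)
      (fun (c : U → Bool) _ => hfun (fun x => c (h x)))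
    rw [Finset.sum_add_distrib] at hs
    have e1 : ∑ c : U → Bool, ∑ x, ∑ y, μ x * μ y *
        (if c (h x) = c (h y) then (1:ℝ) else 0) =
        N / 2 * (1 + ∑ x, ∑ y, μ x * μ y * (if h x = h y then (1:ℝ) else 0)) := by
      have h1 : (1:ℝ) = ∑ x, ∑ y, μ x * μ y := by
        rw [← Finset.sum_mul_sum, hμ1, one_mul]
      conv_rhs => rw [show ∀ t : ℝ, N / 2 * (1 + t) = N / 2 * ((∑ x, ∑ y, μ x * μ y) + t) from
        fun t => by rw [← h1]]
      rw [← Finset.sum_add_distrib, Finset.mul_sum, Finset.sum_comm]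
      refine Finset.sum_congr rfl fun x _ => ?_
      rw [← Finset.sum_add_distrib, Finset.mul_sum, Finset.sum_comm]
      refine Finset.sum_congr rfl fun y _ => ?_
      rw [← Finset.mul_sum, color_eq_sum]
      ring
    have e2 : ∑ c : U → Bool, ∑ p : X × X, ρ p *
        (if c (h p.1) ≠ c (h p.2) then (1:ℝ) else 0) =
        N / 2 * (1 - ∑ p : X × X, ρ p * (if h p.1 = h p.2 then (1:ℝ) else 0)) := by
      rw [show ∀ t : ℝ, N / 2 * (1 - t) = N / 2 * ((∑ p, ρ p) - t) from
        fun t => by rw [hρ1]]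
      rw [← Finset.sum_sub_distrib, Finset.mul_sum, Finset.sum_comm]
      refine Finset.sum_congr rfl fun p _ => ?_
      rw [← Finset.mul_sum, color_ne_sum]
      ring
    rw [e1, e2] at hs
    simp only [Finset.sum_const, Finset.card_univ, nsmul_eq_mul] at hs
    rw [← hN] at hs
    refine le_of_mul_le_mul_left ?_ hNpos
    linarith
  have hsum := Finset.sum_le_sum (s := Finset.univ)
    (fun (h : X → U) _ => mul_le_mul_of_nonneg_left (key h) (hH0 h))
  rw [← Finset.sum_mul, hH1, one_mul] at hsum
  simp only [mul_sub, Finset.sum_sub_distrib, Finset.mul_sum, ← mul_assoc] at hsum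
  linarith
end

section
/- Fix d, s, ℓ ∈ ℕ with d ≥ 1, s ≥ 1, and a threshold τ > 0 such that q := d/(τ·2^{ℓ+1}) ≤ 1. Consider the following random hash function h on s-tuples of points of {0,1}^d: sample 2^ℓ coordinates i₁,…,i_{2^ℓ} independently and uniformly from {1,…,d}, defining the projection φ(a) = (a_{i₁},…,a_{i_{2^ℓ}}) ∈ {0,1}^{2^ℓ}; independently of the coordinates, sample bits C_{u,k} ~ Bernoulli(q) independently for every u ∈ {0,1}^{2^ℓ} and k ∈ {1,…,s}; for an s-tuple x with entries a₁,…,a_s ∈ {0,1}^d set χ(x,u,k) = 1 if at least k of the entries a of x satisfy φ(a) = u (and χ(x,u,k) = 0 otherwise), and define h(x) = (C_{u,k}·χ(x,u,k))_{u ∈ {0,1}^{2^ℓ}, k ∈ {1,…,s}}. Then for every pair of s-tuples x, y of points of {0,1}^d, Pr[h(x) ≠ h(y)] ≤ EMD(x,y)/τ. -/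
open Finset

/-- The projection of a point of the hypercube onto a tuple of sampled coordinates. -/
def proj {d m : ℕ} (iv : Fin m → Fin d) (a : Fin d → Bool) : Fin m → Bool :=
  fun t => a (iv t)

/-- `chi iv x u k = 1` iff at least `k+1` entries of the tuple `x` project to `u`
(so `k : Fin s` encodes the value `k+1 ∈ {1,…,s}`). -/
def chi {d s m : ℕ} (iv : Fin m → Fin d) (x : Fin s → Fin d → Bool)
    (u : Fin m → Bool) (k : Fin s) : Bool :=
  decide (k.1 + 1 ≤ (Finset.univ.filter fun i : Fin s => proj iv (x i) = u).card)

/-- The hash `h(x) = (C_{u,k} · χ(x,u,k))_{u,k}` of the tuple `x`. -/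
def hashH {d s m : ℕ} (iv : Fin m → Fin d)
    (C : (Fin m → Bool) × Fin s → Bool) (x : Fin s → Fin d → Bool) :
    (Fin m → Bool) × Fin s → Bool :=
  fun p => C p && chi iv x p.1 p.2

/-- Earth Mover's distance between `s`-tuples of points of the hypercube `{0,1}^d`,
with the Hamming distance as ground metric. -/
noncomputable def EMDbool {d s : ℕ} (x y : Fin s → Fin d → Bool) : ℝ :=
  Finset.inf' Finset.univ ⟨Equiv.refl (Fin s), Finset.mem_univ _⟩
    fun σ : Equiv.Perm (Fin s) => ∑ i, (hammingDist (x i) (y (σ i)) : ℝ)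

lemma aux_marg {ι κ : Type*} [Fintype ι] [DecidableEq ι] [Fintype κ] (w g : κ → ℝ)
    (hw : ∑ b, w b = 1) (i0 : ι) :
    ∑ f : ι → κ, (∏ i, w (f i)) * g (f i0) = ∑ b, w b * g b := by
  classical
  have h := Finset.prod_univ_sum (fun _ : ι => (Finset.univ : Finset κ))
    (fun i b => w b * (if i = i0 then g b else 1))
  rw [Fintype.piFinset_univ] at h
  have h2 : ∀ f : ι → κ, ∏ i, (w (f i) * (if i = i0 then g (f i) else 1))
      = (∏ i, w (f i)) * g (f i0) := by
    intro f
    rw [Finset.prod_mul_distrib]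
    simp
  simp only [h2] at h
  rw [← h, Finset.prod_eq_single i0]
  · simp
  · intro b _ hb
    simp [hb, hw]
  · simp

lemma aux_count (s a b : ℕ) :
    ∑ k : Fin s, (if decide (k.1 + 1 ≤ a) ≠ decide (k.1 + 1 ≤ b) then (1 : ℝ) else 0)
      ≤ |(a : ℝ) - b| := by
  wlog hab : a ≤ b generalizing a b
  · have := this b a (by omega)
    rw [abs_sub_comm]
    refine le_trans (le_of_eq ?_) this
    refine Finset.sum_congr rfl fun k _ => ?_
    simp only [ne_comm]
  rw [Finset.sum_boole]
  have h : (Finset.univ.filter fun k : Fin s =>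
      decide (k.1 + 1 ≤ a) ≠ decide (k.1 + 1 ≤ b)).card ≤ b - a := by
    rw [← Nat.card_Ico a b]
    refine Finset.card_le_card_of_injOn (fun k => k.1) ?_ ?_
    · intro k hk
      simp only [Finset.coe_filter, Set.mem_ofPred_eq, Finset.mem_univ, true_and] at hk
      simp only [Finset.coe_Ico, Set.mem_Ico]
      by_cases h1 : k.1 + 1 ≤ a <;> by_cases h2 : k.1 + 1 ≤ b <;> simp [h1, h2] at hk <;> omega
    · intro k _ k' _ h
      exact Fin.ext h
  have h' : (((Finset.univ.filter fun k : Fin s =>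
      decide (k.1 + 1 ≤ a) ≠ decide (k.1 + 1 ≤ b)).card : ℕ) : ℝ) ≤ ((b - a : ℕ) : ℝ) := by
    exact_mod_cast h
  rw [Nat.cast_sub hab] at h'
  refine h'.trans ?_
  rw [abs_sub_comm]
  exact le_abs_self _

lemma aux_chi {d s m : ℕ} (iv : Fin m → Fin d) (x y : Fin s → Fin d → Bool)
    (σ : Equiv.Perm (Fin s)) :
    ∑ p : (Fin m → Bool) × Fin s, (if chi iv x p.1 p.2 ≠ chi iv y p.1 p.2 then (1 : ℝ) else 0)
      ≤ ∑ i, 2 * (if proj iv (x i) ≠ proj iv (y (σ i)) then (1 : ℝ) else 0) := by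
  rw [Fintype.sum_prod_type]
  calc _ ≤ ∑ u : Fin m → Bool, ∑ i, |(if proj iv (x i) = u then (1 : ℝ) else 0)
            - (if proj iv (y (σ i)) = u then (1 : ℝ) else 0)| := by
        refine Finset.sum_le_sum fun u _ => ?_
        simp only [chi]
        refine (aux_count s _ _).trans ?_
        rw [← Finset.sum_boole, ← Finset.sum_boole,
          ← Equiv.sum_comp σ (fun i => if proj iv (y i) = u then (1 : ℝ) else 0),
          ← Finset.sum_sub_distrib]
        exact Finset.abs_sum_le_sum_abs _ _
    _ ≤ _ := by
        rw [Finset.sum_comm]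
        refine Finset.sum_le_sum fun i _ => ?_
        by_cases h : proj iv (x i) = proj iv (y (σ i))
        · simp [h]
        · calc _ ≤ ∑ u : Fin m → Bool, ((if proj iv (x i) = u then (1 : ℝ) else 0)
                + (if proj iv (y (σ i)) = u then (1 : ℝ) else 0)) := by
                refine Finset.sum_le_sum fun u _ => ?_
                split_ifs <;> norm_num
            _ = _ := by
                rw [Finset.sum_add_distrib]
                simp [h]
                norm_num

lemma aux_proj {d m : ℕ} (hd : 1 ≤ d) (a b : Fin d → Bool) :
    ∑ iv : Fin m → Fin d, (1 / (d : ℝ) ^ m) * (if proj iv a ≠ proj iv b then (1 : ℝ) else 0)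
      ≤ m * ((1 / d) * (hammingDist a b : ℝ)) := by
  have hd' : (d : ℝ) ≠ 0 := by positivity
  calc _ ≤ ∑ iv : Fin m → Fin d, ∑ t : Fin m, (∏ _i : Fin m, (1 / (d : ℝ))) *
            (if a (iv t) ≠ b (iv t) then (1 : ℝ) else 0) := by
        refine Finset.sum_le_sum fun iv _ => ?_
        rw [← Finset.mul_sum]
        simp only [Finset.prod_const, Finset.card_univ, Fintype.card_fin, one_div, inv_pow]
        refine mul_le_mul_of_nonneg_left ?_ (by positivity)
        split_ifs with h
        · obtain ⟨t, ht⟩ := Function.ne_iff.mp h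
          refine le_trans ?_ (Finset.single_le_sum
            (f := fun t => if a (iv t) ≠ b (iv t) then (1 : ℝ) else 0)
            (fun t _ => by split_ifs <;> norm_num) (Finset.mem_univ t))
          simp only [proj] at ht
          simp [ht]
        · exact Finset.sum_nonneg fun t _ => by split_ifs <;> norm_num
    _ = _ := by
        rw [Finset.sum_comm]
        have := fun t : Fin m => aux_marg (fun _ : Fin d => 1 / (d : ℝ))
          (fun j => if a j ≠ b j then (1 : ℝ) else 0) (by simp [hd']) t
        simp only [this]
        rw [Finset.sum_const, ← Finset.mul_sum, Finset.sum_boole]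
        simp [hammingDist]

lemma aux_hash {d s m : ℕ} (q : ℝ) (h0 : 0 ≤ q) (h1 : q ≤ 1) (iv : Fin m → Fin d)
    (x y : Fin s → Fin d → Bool) :
    ∑ C : (Fin m → Bool) × Fin s → Bool,
      (∏ p : (Fin m → Bool) × Fin s, (if C p then q else 1 - q)) *
        (if hashH iv C x ≠ hashH iv C y then (1 : ℝ) else 0)
      ≤ q * ∑ p : (Fin m → Bool) × Fin s,
          (if chi iv x p.1 p.2 ≠ chi iv y p.1 p.2 then (1 : ℝ) else 0) := by
  calc _ ≤ ∑ C : (Fin m → Bool) × Fin s → Bool, ∑ p' : (Fin m → Bool) × Fin s,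
        ((∏ p : (Fin m → Bool) × Fin s, (if C p then q else 1 - q)) *
          (if C p' then (1 : ℝ) else 0)) *
          (if chi iv x p'.1 p'.2 ≠ chi iv y p'.1 p'.2 then (1 : ℝ) else 0) := by
        refine Finset.sum_le_sum fun C _ => ?_
        simp only [mul_assoc]
        rw [← Finset.mul_sum]
        refine mul_le_mul_of_nonneg_left ?_
          (Finset.prod_nonneg fun p _ => by split_ifs <;> linarith)
        have hn : ∀ p : (Fin m → Bool) × Fin s, 0 ≤ (if C p then (1 : ℝ) else 0) *
          (if chi iv x p.1 p.2 ≠ chi iv y p.1 p.2 then (1 : ℝ) else 0) := fun p => by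
            split_ifs <;> norm_num
        split_ifs with h
        · obtain ⟨p, hp⟩ := Function.ne_iff.mp h
          refine le_trans ?_ (Finset.single_le_sum (fun p _ => hn p) (Finset.mem_univ p))
          simp only [hashH] at hp
          have hC : C p = true := by
            by_contra hC
            rw [Bool.not_eq_true] at hC
            rw [hC] at hp
            exact hp rfl
          have hc : chi iv x p.1 p.2 ≠ chi iv y p.1 p.2 := by
            simpa [hC] using hp
          simp [hC, hc]
        · exact Finset.sum_nonneg fun p _ => hn p
    _ = _ := by
        rw [Finset.sum_comm, Finset.mul_sum]
        refine Finset.sum_congr rfl fun p' _ => ?_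
        rw [← Finset.sum_mul]
        have := aux_marg (fun b : Bool => if b then q else 1 - q)
          (fun b => if b then (1 : ℝ) else 0) (by simp) p'
        rw [this]
        simp

/-- the hash family `H(τ,ℓ)` separates two `s`-tuples with probability
at most `EMD(x,y)/τ`.  The probability is written explicitly: the coordinates
`iv : Fin 2^ℓ → Fin d` are uniform (weight `1/d^{2^ℓ}`) and each bit `C (u,k)`
is an independent Bernoulli with parameter `q = d/(τ·2^{ℓ+1})`. -/
theorem stmt_1 (d s ℓ : ℕ) (hd : 1 ≤ d) (hs : 1 ≤ s) (τ : ℝ) (hτ : 0 < τ)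
    (hq : (d : ℝ) / (τ * 2 ^ (ℓ + 1)) ≤ 1)
    (x y : Fin s → Fin d → Bool) :
    ∑ iv : Fin (2 ^ ℓ) → Fin d, ∑ C : (Fin (2 ^ ℓ) → Bool) × Fin s → Bool,
      ((1 / (d : ℝ) ^ (2 ^ ℓ)) *
        ∏ p : (Fin (2 ^ ℓ) → Bool) × Fin s,
          (if C p then (d : ℝ) / (τ * 2 ^ (ℓ + 1))
           else 1 - (d : ℝ) / (τ * 2 ^ (ℓ + 1)))) *
      (if hashH iv C x ≠ hashH iv C y then (1 : ℝ) else 0)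
    ≤ EMDbool x y / τ := by
  have hd' : (d : ℝ) ≠ 0 := by positivity
  obtain ⟨σ, -, hσ⟩ := Finset.exists_mem_eq_inf' (s := (Finset.univ : Finset (Equiv.Perm (Fin s))))
    ⟨Equiv.refl (Fin s), Finset.mem_univ _⟩
    (fun σ : Equiv.Perm (Fin s) => ∑ i, (hammingDist (x i) (y (σ i)) : ℝ))
  rw [EMDbool, hσ]
  set q : ℝ := (d : ℝ) / (τ * 2 ^ (ℓ + 1)) with hqd
  have h0 : 0 ≤ q := by positivity
  calc _ ≤ ∑ iv : Fin (2 ^ ℓ) → Fin d, (1 / (d : ℝ) ^ (2 ^ ℓ)) * (q *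
            ∑ i, 2 * (if proj iv (x i) ≠ proj iv (y (σ i)) then (1 : ℝ) else 0)) := by
        refine Finset.sum_le_sum fun iv _ => ?_
        simp only [mul_assoc]
        rw [← Finset.mul_sum]
        refine mul_le_mul_of_nonneg_left ?_ (by positivity)
        refine (aux_hash q h0 hq iv x y).trans ?_
        exact mul_le_mul_of_nonneg_left (aux_chi iv x y σ) h0
    _ = ∑ i, (2 * q) * ∑ iv : Fin (2 ^ ℓ) → Fin d, (1 / (d : ℝ) ^ (2 ^ ℓ)) *
            (if proj iv (x i) ≠ proj iv (y (σ i)) then (1 : ℝ) else 0) := by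
        simp only [Finset.mul_sum]
        rw [Finset.sum_comm]
        refine Finset.sum_congr rfl fun i _ => Finset.sum_congr rfl fun iv _ => ?_
        ring
    _ ≤ ∑ i, (2 * q) * (((2 ^ ℓ : ℕ) : ℝ) * ((1 / d) * (hammingDist (x i) (y (σ i)) : ℝ))) := by
        refine Finset.sum_le_sum fun i _ => ?_
        exact mul_le_mul_of_nonneg_left (aux_proj hd _ _) (by positivity)
    _ = _ := by
        rw [Finset.sum_div]
        refine Finset.sum_congr rfl fun i _ => ?_
        rw [hqd]
        push_cast
        field_simp
        ring
end

section
/- Fix d ≥ 1 and a threshold R > 0. Sample d independent copies g₁,…,g_d of the one-coordinate grid hash (each g_j is given by an independent uniform coordinate i*_j ∈ {1,…,d} and an independent uniform shift β_j ∈ [0,R], with g_j(x) = ⌈(x_{i*_j} + β_j)/R⌉), and define h(x) = (g₁(x),…,g_d(x)). Then for any a, b ∈ ℝ^d with ‖a − b‖₁ ≤ R, one has ‖a − b‖₁/(2R) ≤ Pr[h(a) ≠ h(b)] ≤ ‖a − b‖₁/R, and for any a, b ∈ ℝ^d with ‖a − b‖₁ > R, Pr[h(a) ≠ h(b)] > 1/2.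 -/
open Finset MeasureTheory

/-- The probability that the `d`-fold concatenated grid hash separates `a` and `b`:
the `d` sampled coordinates `iv : Fin d → Fin d` are uniform (weight `1/d^d`) and
the `d` shifts `β : Fin d → ℝ` are independent uniforms on `[0,R]` (normalized
product Lebesgue measure on the box, weight `1/R^d`). -/
noncomputable def collP (d : ℕ) (R : ℝ) (a b : Fin d → ℝ) : ℝ :=
  (1 / (d : ℝ) ^ d) * ∑ iv : Fin d → Fin d,
    (volume {β : Fin d → ℝ | (∀ j, β j ∈ Set.Icc (0 : ℝ) R) ∧
      ∃ j, ⌈(a (iv j) + β j) / R⌉ ≠ ⌈(b (iv j) + β j) / R⌉}).toReal / R ^ d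

/-- Shifts in `[0,R]` for which the one-dimensional grid hash does not separate `x` and `y`. -/
def goodSet (R x y : ℝ) : Set ℝ :=
  {β : ℝ | β ∈ Set.Icc (0 : ℝ) R ∧ ⌈(x + β) / R⌉ = ⌈(y + β) / R⌉}

lemma goodSet_comm (R x y : ℝ) : goodSet R x y = goodSet R y x := by
  ext β
  simp only [goodSet, Set.mem_setOf_eq, eq_comm]

lemma goodSet_meas (R x y : ℝ) : MeasurableSet (goodSet R x y) := by
  have h1 : Measurable fun β : ℝ => ⌈(x + β) / R⌉ := by
    apply Int.measurable_ceil.comp; fun_prop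
  have h2 : Measurable fun β : ℝ => ⌈(y + β) / R⌉ := by
    apply Int.measurable_ceil.comp; fun_prop
  exact measurableSet_Icc.inter (measurableSet_eq_fun h1 h2)

lemma goodSet_vol_le (R x y : ℝ) (hR : 0 < R) (hxy : x ≤ y) :
    volume (goodSet R x y) = ENNReal.ofReal (R - min R (y - x)) := by
  by_cases hc : R ≤ y - x
  · have : goodSet R x y = ∅ := by
      ext β
      simp only [goodSet, Set.mem_setOf_eq, Set.mem_empty_iff_false, iff_false, not_and]
      intro _ h
      have h1 : (x + β) / R + 1 ≤ (y + β) / R := by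
        rw [div_add_one hR.ne']
        exact div_le_div_of_nonneg_right (by linarith) hR.le
      have h2 := Int.ceil_mono h1
      rw [Int.ceil_add_one] at h2
      omega
    rw [this, min_eq_left hc]
    simp
  · push Not at hc
    obtain ⟨n, t, ht0, htR, hx⟩ : ∃ (n : ℤ) (t : ℝ), 0 ≤ t ∧ t < R ∧ x = n * R - t := by
      refine ⟨⌈x / R⌉, ⌈x / R⌉ * R - x, ?_, ?_, by ring⟩
      · have := Int.le_ceil (x / R)
        rw [div_le_iff₀ hR] at this
        linarith
      · have := Int.ceil_lt_add_one (x / R)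
        have h2 : (⌈x / R⌉ : ℝ) * R < (x / R + 1) * R := by gcongr
        rw [add_mul, div_mul_cancel₀ _ hR.ne'] at h2
        linarith
    obtain ⟨δ, hδ⟩ : ∃ δ, δ = y - x := ⟨_, rfl⟩
    have hy : y = n * R - t + δ := by linarith
    rw [← hδ] at hc ⊢
    have hδ0 : 0 ≤ δ := by linarith
    have key : ∀ (z : ℝ) (m : ℤ), (n + m - 1) * R < z → z ≤ (n + m) * R → ⌈z / R⌉ = n + m := by
      intro z m h1 h2
      rw [Int.ceil_eq_iff]
      push_cast
      exact ⟨by rwa [lt_div_iff₀ hR], by rwa [div_le_iff₀ hR]⟩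
    have hset : goodSet R x y = Set.Icc 0 (t - δ) ∪ Set.Ioc t (min R (R + t - δ)) := by
      ext β
      simp only [goodSet, Set.mem_setOf_eq, Set.mem_union, Set.mem_Icc, Set.mem_Ioc, le_min_iff]
      by_cases hβ : 0 ≤ β ∧ β ≤ R
      swap
      · constructor
        · rintro ⟨h, _⟩; exact absurd h hβ
        · intro h
          exfalso; apply hβ
          rcases h with h | h <;> constructor <;> linarith [h.1, h.2]
      obtain ⟨hβ0, hβR⟩ := hβ
      have hX : (β ≤ t ∧ ⌈(x + β) / R⌉ = n + 0) ∨ (t < β ∧ ⌈(x + β) / R⌉ = n + 1) := by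
        rcases le_or_gt β t with h | h
        · exact Or.inl ⟨h, key _ 0 (by push_cast; linarith) (by push_cast; linarith)⟩
        · exact Or.inr ⟨h, key _ 1 (by push_cast; linarith) (by push_cast; linarith)⟩
      have hY : (β ≤ t - δ ∧ ⌈(y + β) / R⌉ = n + 0) ∨
          (t - δ < β ∧ β ≤ R + t - δ ∧ ⌈(y + β) / R⌉ = n + 1) ∨
          (R + t - δ < β ∧ ⌈(y + β) / R⌉ = n + 2) := by
        rcases le_or_gt β (t - δ) with h | h
        · exact Or.inl ⟨h, key _ 0 (by push_cast; linarith) (by push_cast; linarith)⟩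
        · rcases le_or_gt β (R + t - δ) with h' | h'
          · exact Or.inr (Or.inl
              ⟨h, h', key _ 1 (by push_cast; linarith) (by push_cast; linarith)⟩)
          · exact Or.inr (Or.inr
              ⟨h', key _ 2 (by push_cast; linarith) (by push_cast; linarith)⟩)
      rcases hX with ⟨h1, e1⟩ | ⟨h1, e1⟩ <;> rcases hY with ⟨h2, e2⟩ | ⟨h2, h3, e2⟩ | ⟨h2, e2⟩ <;>
        rw [e1, e2]
      · simp [hβ0, hβR, h2]
      · simp; constructor <;> intros <;> linarith
      · simp; constructor <;> intros <;> linarith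
      · exfalso; linarith
      · simp [hβ0, hβR, h1, h3]
      · simp; constructor <;> intros <;> linarith
    have hdisj : Disjoint (Set.Icc 0 (t - δ)) (Set.Ioc t (min R (R + t - δ))) := by
      rw [Set.disjoint_left]
      rintro β ⟨_, h1⟩ ⟨h2, _⟩
      linarith
    rw [hset, measure_union hdisj measurableSet_Ioc, Real.volume_Icc, Real.volume_Ioc,
      min_eq_right hc.le]
    rcases le_total δ t with h | h
    · rw [min_eq_left (by linarith), ← ENNReal.ofReal_add (by linarith) (by linarith)]
      congr 1; ring
    · rw [min_eq_right (by linarith), ENNReal.ofReal_of_nonpos (p := t - δ - 0) (by linarith),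
        zero_add]
      congr 1; ring

lemma goodSet_vol (R x y : ℝ) (hR : 0 < R) :
    volume (goodSet R x y) = ENNReal.ofReal (R - min R |x - y|) := by
  rcases le_total x y with h | h
  · rw [goodSet_vol_le R x y hR h, abs_of_nonpos (by linarith)]
    congr 3; ring
  · rw [goodSet_comm, goodSet_vol_le R y x hR h, abs_of_nonneg (by linarith)]

lemma badSet_vol (d : ℕ) (R : ℝ) (hR : 0 < R) (u v : Fin d → ℝ) :
    (volume {β : Fin d → ℝ | (∀ j, β j ∈ Set.Icc (0 : ℝ) R) ∧
      ∃ j, ⌈(u j + β j) / R⌉ ≠ ⌈(v j + β j) / R⌉}).toReal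
      = R ^ d - ∏ j, (R - min R |u j - v j|) := by
  have hset : {β : Fin d → ℝ | (∀ j, β j ∈ Set.Icc (0 : ℝ) R) ∧
      ∃ j, ⌈(u j + β j) / R⌉ ≠ ⌈(v j + β j) / R⌉}
      = (Set.univ.pi fun _ => Set.Icc (0 : ℝ) R) \ (Set.univ.pi fun j => goodSet R (u j) (v j)) := by
    ext β
    simp only [goodSet, Set.mem_setOf_eq, Set.mem_diff, Set.mem_univ_pi]
    constructor
    · rintro ⟨h, j, hj⟩
      exact ⟨h, fun hh => hj (hh j).2⟩
    · rintro ⟨h, h2⟩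
      refine ⟨h, ?_⟩
      by_contra! hh
      exact h2 fun j => ⟨h j, hh j⟩
  have hnn : ∀ j, 0 ≤ R - min R |u j - v j| := fun j => by
    have := min_le_left R |u j - v j|
    linarith
  have hg : volume (Set.univ.pi fun j => goodSet R (u j) (v j))
      = ENNReal.ofReal (∏ j, (R - min R |u j - v j|)) := by
    rw [volume_pi_pi, ENNReal.ofReal_prod_of_nonneg (fun j _ => hnn j)]
    exact Finset.prod_congr rfl fun j _ => goodSet_vol R _ _ hR
  have hb : volume (Set.univ.pi fun _ : Fin d => Set.Icc (0 : ℝ) R) = ENNReal.ofReal (R ^ d) := by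
    rw [volume_pi_pi, ENNReal.ofReal_pow hR.le]
    simp
  have hsub : (Set.univ.pi fun j => goodSet R (u j) (v j)) ⊆
      (Set.univ.pi fun _ => Set.Icc (0 : ℝ) R) := Set.pi_mono fun j _ β h => h.1
  rw [hset, measure_diff hsub
    (MeasurableSet.univ_pi fun j => goodSet_meas R _ _).nullMeasurableSet
    (by rw [hg]; exact ENNReal.ofReal_ne_top), hg, hb,
    ← ENNReal.ofReal_sub _ (Finset.prod_nonneg fun j _ => hnn j), ENNReal.toReal_ofReal]
  have : ∏ j, (R - min R |u j - v j|) ≤ ∏ _j : Fin d, R := by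
    apply Finset.prod_le_prod (fun j _ => hnn j)
    intro j _
    have : 0 ≤ min R |u j - v j| := le_min hR.le (abs_nonneg _)
    linarith
  simp at this
  linarith

lemma collP_eq (d : ℕ) (hd : 1 ≤ d) (R : ℝ) (hR : 0 < R) (a b : Fin d → ℝ) :
    collP d R a b = 1 - (1 - (∑ i, min R |a i - b i|) / R / d) ^ d := by
  have hd0 : (d : ℝ) ≠ 0 := by positivity
  unfold collP
  have h1 : ∀ iv : Fin d → Fin d, (volume {β : Fin d → ℝ | (∀ j, β j ∈ Set.Icc (0 : ℝ) R) ∧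
      ∃ j, ⌈(a (iv j) + β j) / R⌉ ≠ ⌈(b (iv j) + β j) / R⌉}).toReal / R ^ d
      = 1 - (∏ j, (R - min R |a (iv j) - b (iv j)|)) / R ^ d := by
    intro iv
    rw [badSet_vol d R hR (fun j => a (iv j)) (fun j => b (iv j)), sub_div,
      div_self (by positivity)]
  have h2 : ∑ iv : Fin d → Fin d, ∏ j, (R - min R |a (iv j) - b (iv j)|)
      = (∑ i, (R - min R |a i - b i|)) ^ d := by
    have := Finset.prod_univ_sum (fun _ : Fin d => (Finset.univ : Finset (Fin d)))
      (fun _ i => R - min R |a i - b i|)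
    simp only [Finset.prod_const, Finset.card_univ, Fintype.card_fin,
      Fintype.piFinset_univ] at this
    exact this.symm
  simp only [h1]
  rw [Finset.sum_sub_distrib, ← Finset.sum_div, h2, Finset.sum_sub_distrib]
  simp only [Finset.sum_const, Finset.card_univ, Fintype.card_fin, Fintype.card_pi,
    Finset.prod_const, nsmul_eq_mul, mul_one, Nat.cast_pow]
  have h3 : 1 - (∑ i, min R |a i - b i|) / R / d = (d * R - ∑ i, min R |a i - b i|) / (d * R) := by
    field_simp
  rw [h3, div_pow, mul_pow]
  field_simp

/-- the `d`-fold concatenation of independent one-coordinate grid hashes: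
for `‖a-b‖₁ ≤ R` the separation probability is between `‖a-b‖₁/(2R)` and `‖a-b‖₁/R`,
and for `‖a-b‖₁ > R` it exceeds `1/2`. -/
theorem stmt_4 (d : ℕ) (hd : 1 ≤ d) (R : ℝ) (hR : 0 < R) (a b : Fin d → ℝ) :
    ((∑ i, |a i - b i|) ≤ R →
      (∑ i, |a i - b i|) / (2 * R) ≤ collP d R a b ∧
        collP d R a b ≤ (∑ i, |a i - b i|) / R) ∧
    (R < (∑ i, |a i - b i|) → 1 / 2 < collP d R a b) := by
  rw [collP_eq d hd R hR]
  have hd0 : (0 : ℝ) < d := by positivity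
  obtain ⟨S, hS⟩ : ∃ S, S = (∑ i, min R |a i - b i|) / R := ⟨_, rfl⟩
  rw [← hS]
  have hS0 : 0 ≤ S := by
    rw [hS]
    exact div_nonneg (Finset.sum_nonneg fun i _ => le_min hR.le (abs_nonneg _)) hR.le
  have hSd : S ≤ d := by
    rw [hS, div_le_iff₀ hR]
    calc _ ≤ ∑ _i : Fin d, R := Finset.sum_le_sum fun i _ => min_le_left _ _
      _ = d * R := by simp
  have hexp : (1 - S / d) ^ d ≤ Real.exp (-S) := Real.one_sub_div_pow_le_exp_neg hSd
  have hinv : Real.exp (-S) * (1 + S) ≤ 1 := by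
    have h := Real.add_one_le_exp S
    calc Real.exp (-S) * (1 + S) ≤ Real.exp (-S) * Real.exp S := by gcongr; linarith
      _ = 1 := by rw [← Real.exp_add]; simp
  constructor
  · intro hle
    have hSeq : S = (∑ i, |a i - b i|) / R := by
      rw [hS]
      congr 1
      refine Finset.sum_congr rfl fun i _ => min_eq_right ?_
      exact (Finset.single_le_sum (f := fun i => |a i - b i|) (fun i _ => abs_nonneg _)
        (Finset.mem_univ i)).trans hle
    have hS1 : S ≤ 1 := by rw [hSeq, div_le_one hR]; exact hle
    have h2 : (∑ i, |a i - b i|) / (2 * R) = S / 2 := by rw [hSeq]; field_simp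
    rw [h2, ← hSeq]
    constructor
    · have : Real.exp (-S) ≤ 1 - S / 2 := by
        have h : 1 ≤ (1 - S / 2) * (1 + S) := by nlinarith
        have := hinv.trans h
        exact le_of_mul_le_mul_right this (by linarith)
      linarith
    · have hb := one_add_mul_le_pow (a := -(S / d)) (by
        have : S / d ≤ 1 := by rw [div_le_one hd0]; exact hSd
        linarith) d
      have e : (d : ℝ) * -(S / d) = -S := by field_simp
      rw [e, ← sub_eq_add_neg 1 (S / d)] at hb
      linarith
  · intro hlt
    have hS1 : 1 ≤ S := by
      rw [hS, le_div_iff₀ hR, one_mul]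
      by_cases h : ∃ i, R ≤ |a i - b i|
      · obtain ⟨i, hi⟩ := h
        have := Finset.single_le_sum (f := fun i => min R |a i - b i|)
          (fun i _ => le_min hR.le (abs_nonneg _)) (Finset.mem_univ i)
        simp only [min_eq_left hi] at this
        exact this
      · push Not at h
        rw [Finset.sum_congr rfl fun i _ => min_eq_right (h i).le]
        exact hlt.le
    have h1 : Real.exp (-S) ≤ Real.exp (-1) := Real.exp_le_exp.mpr (by linarith)
    have h2 : Real.exp (-1) < 1 / 2 := by
      have := Real.exp_neg_one_lt_d9
      linarith
    linarith
end

section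
/- Let d ≥ 1, r ∈ ℕ, a, p ∈ {0,1}^d, and let j : {1,…,r} → {1,…,d} be any sequence of coordinates. Suppose that for every p' ∈ {0,1}^d with Hamming distance at most 1 from p, there exists k ∈ {1,…,r} with a_{j(k)} ≠ p'_{j(k)}. Then there exist distinct indices k₁, k₂ ∈ {1,…,r} such that a_{j(k₁)} ≠ p_{j(k₁)} and a_{j(k₂)} ≠ p_{j(k₂)}. -/
/-- if the sampled coordinates `j 1, …, j r` separate `a` from every
point `p'` within Hamming distance 1 of `p`, then two distinct sampled coordinates
witness a disagreement between `a` and `p` itself. -/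
theorem stmt_7 (d r : ℕ) (hd : 1 ≤ d) (a p : Fin d → Bool) (j : Fin r → Fin d)
    (h : ∀ p' : Fin d → Bool, hammingDist p p' ≤ 1 →
      ∃ k : Fin r, a (j k) ≠ p' (j k)) :
    ∃ k₁ k₂ : Fin r, k₁ ≠ k₂ ∧ a (j k₁) ≠ p (j k₁) ∧ a (j k₂) ≠ p (j k₂) := by
  obtain ⟨k₁, h₁⟩ := h p (by simp)
  have hdist : hammingDist p (Function.update p (j k₁) (a (j k₁))) ≤ 1 := by
    unfold hammingDist
    refine (Finset.card_le_card (t := {j k₁}) ?_).trans (by simp)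
    intro i hi
    by_contra hne
    have hne' : i ≠ j k₁ := by simpa using hne
    simp [Function.update_of_ne hne'] at hi
  obtain ⟨k₂, h₂⟩ := h _ hdist
  have hj : j k₂ ≠ j k₁ := by
    intro e
    rw [e, Function.update_self] at h₂
    exact h₂ rfl
  rw [Function.update_of_ne hj] at h₂
  exact ⟨k₁, k₂, fun e => hj (by rw [e]), h₁, h₂⟩
end

section
/- Let d ≥ 1, r ∈ ℕ, let a, b ∈ {0,1}^d, and let Ω ⊆ {0,1}^d be a finite nonempty set. Let p ∈ Ω minimize ‖a − p‖₁ over Ω and let p̃ ∈ Ω minimize ‖b − p̃‖₁ over Ω. Sample r coordinates j₁,…,j_r independently and uniformly from {1,…,d}. Then Pr[ ∃ distinct k₁, k₂ ∈ {1,…,r} such that a_{j_{k₁}} ≠ b_{j_{k₁}} and b_{j_{k₂}} ≠ p̃_{j_{k₂}} ] ≤ (r/d)² · ‖a − b‖₁ · ( ‖a − b‖₁ + ‖a − p‖₁ ). -/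
open Finset

lemma pair_count (d r : ℕ) (hd : 1 ≤ d) (A B : Finset (Fin d)) (k₁ k₂ : Fin r) (h : k₁ ≠ k₂) :
    (#{j : Fin r → Fin d | j k₁ ∈ A ∧ j k₂ ∈ B} : ℝ) = (#A / d : ℝ) * (#B / d) * d ^ r := by
  have hd0 : (d : ℝ) ≠ 0 := by positivity
  have e : ({j : Fin r → Fin d | j k₁ ∈ A ∧ j k₂ ∈ B} : Finset _) =
      Fintype.piFinset (fun k => if k = k₁ then A else if k = k₂ then B else univ) := by
    ext j
    simp only [mem_filter, mem_univ, true_and, Fintype.mem_piFinset]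
    constructor
    · rintro ⟨h1, h2⟩ k
      split_ifs with h3 h4
      · exact h3 ▸ h1
      · exact h4 ▸ h2
      · exact mem_univ _
    · intro H
      have h1 := H k₁
      have h2 := H k₂
      rw [if_pos rfl] at h1
      rw [if_neg h.symm, if_pos rfl] at h2
      exact ⟨h1, h2⟩
  rw [e, Fintype.card_piFinset]
  push_cast
  have : ∀ k : Fin r, ((#(if k = k₁ then A else if k = k₂ then B else univ) : ℕ) : ℝ) =
      (if k = k₁ then (#A / d : ℝ) else 1) * (if k = k₂ then (#B / d : ℝ) else 1) * d := by
    intro k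
    by_cases h3 : k = k₁
    · have h4 : k ≠ k₂ := fun h4 => h (h3 ▸ h4)
      simp only [if_pos h3, if_neg h4]
      field_simp
    · by_cases h4 : k = k₂
      · simp only [if_neg h3, if_pos h4]
        field_simp
      · simp [if_neg h3, if_neg h4]
  rw [Finset.prod_congr rfl (fun k _ => this k), prod_mul_distrib, prod_mul_distrib]
  simp

/-- with `p` a nearest neighbor of `a` in `Ω` and `p̃` a nearest
neighbor of `b` in `Ω` (Hamming distance), the probability that two distinct
uniformly sampled coordinates respectively witness `a ≠ b` and `b ≠ p̃` is at most
`(r/d)² ‖a−b‖₁ (‖a−b‖₁ + ‖a−p‖₁)`. -/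
theorem stmt_9 (d r : ℕ) (hd : 1 ≤ d) (a b : Fin d → Bool)
    (Ω : Finset (Fin d → Bool)) (hΩ : Ω.Nonempty)
    (p : Fin d → Bool) (hp : p ∈ Ω)
    (hpmin : ∀ q ∈ Ω, hammingDist a p ≤ hammingDist a q)
    (p' : Fin d → Bool) (hp' : p' ∈ Ω)
    (hp'min : ∀ q ∈ Ω, hammingDist b p' ≤ hammingDist b q) :
    (1 / (d : ℝ) ^ r) * ∑ j : Fin r → Fin d,
      (if ∃ k₁ k₂ : Fin r, k₁ ≠ k₂ ∧ a (j k₁) ≠ b (j k₁) ∧ b (j k₂) ≠ p' (j k₂)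
        then (1 : ℝ) else 0)
    ≤ ((r : ℝ) / d) ^ 2 * (hammingDist a b : ℝ) *
        ((hammingDist a b : ℝ) + (hammingDist a p : ℝ)) := by
  have hd0 : (0 : ℝ) < d := by positivity
  have hB : (hammingDist b p' : ℝ) ≤ (hammingDist a b : ℝ) + (hammingDist a p : ℝ) := by
    have h1 := hp'min p hp
    have h2 := hammingDist_triangle b a p
    rw [hammingDist_comm b a] at h2
    exact_mod_cast h1.trans h2
  have key : ∑ j : Fin r → Fin d,
      (if ∃ k₁ k₂ : Fin r, k₁ ≠ k₂ ∧ a (j k₁) ≠ b (j k₁) ∧ b (j k₂) ≠ p' (j k₂)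
        then (1 : ℝ) else 0) ≤
      ∑ _k₁ : Fin r, ∑ _k₂ : Fin r,
        ((hammingDist a b / d : ℝ) * (hammingDist b p' / d) * d ^ r) := by
    calc _ ≤ ∑ j : Fin r → Fin d, ∑ k₁ : Fin r, ∑ k₂ : Fin r,
          (if k₁ ≠ k₂ ∧ a (j k₁) ≠ b (j k₁) ∧ b (j k₂) ≠ p' (j k₂) then (1 : ℝ) else 0) := by
          refine sum_le_sum fun j _ => ?_
          have nn : ∀ k₁ k₂ : Fin r, (0 : ℝ) ≤
            (if k₁ ≠ k₂ ∧ a (j k₁) ≠ b (j k₁) ∧ b (j k₂) ≠ p' (j k₂) then (1 : ℝ) else 0) := by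
            intro k₁ k₂
            split_ifs <;> norm_num
          split_ifs with hE
          · obtain ⟨k₁, k₂, hk⟩ := hE
            have s1 := single_le_sum (fun k _ => nn k₁ k) (mem_univ k₂)
            have s2 := single_le_sum
              (fun k _ => sum_nonneg (s := univ) (fun k' _ => nn k k')) (mem_univ k₁)
            rw [if_pos hk] at s1
            exact s1.trans s2
          · exact sum_nonneg fun k _ => sum_nonneg fun k' _ => nn k k'
      _ = ∑ k₁ : Fin r, ∑ k₂ : Fin r, ∑ j : Fin r → Fin d,
          (if k₁ ≠ k₂ ∧ a (j k₁) ≠ b (j k₁) ∧ b (j k₂) ≠ p' (j k₂) then (1 : ℝ) else 0) := by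
          rw [sum_comm]
          exact sum_congr rfl fun k _ => sum_comm
      _ ≤ _ := by
          refine sum_le_sum fun k₁ _ => sum_le_sum fun k₂ _ => ?_
          by_cases hk : k₁ = k₂
          · simp only [hk, ne_eq, not_true_eq_false, false_and, if_false, sum_const_zero]
            positivity
          · have := pair_count d r hd (univ.filter fun i => a i ≠ b i)
              (univ.filter fun i => b i ≠ p' i) k₁ k₂ hk
            simp only [mem_filter, mem_univ, true_and] at this
            rw [sum_boole]
            simp only [ne_eq, hk, not_false_eq_true, true_and]
            exact this.le
  simp only [sum_const, card_univ, Fintype.card_fin, nsmul_eq_mul] at key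
  calc _ ≤ (1 / (d : ℝ) ^ r) * (r * (r *
        ((hammingDist a b / d : ℝ) * (hammingDist b p' / d) * d ^ r))) := by gcongr
    _ = ((r : ℝ) / d) ^ 2 * (hammingDist a b : ℝ) * (hammingDist b p' : ℝ) := by
        field_simp
    _ ≤ _ := by gcongr
end

section
/- Let A > 0, B ≥ 0, ξ > 0, d > 0 be reals and L ∈ ℕ. Suppose p₀, p₁, …, p_L are reals with 0 ≤ p_ℓ ≤ 1 for all ℓ, and such that for every ℓ ∈ {0,…,L}: p_ℓ ≤ ((2^{ℓ+1} − 1)/d) · A and p_ℓ ≤ ((2^{ℓ+1} − 1)/d)² · A · (A + B). Then ∑_{ℓ=0}^{L} p_ℓ · (d·ξ/2^ℓ) ≤ 8·ξ·A·( log₂(B/A + 1) + 1 ). -/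
open Finset

lemma aux_sum (R s : ℝ) (hR : 1 ≤ R) (hs : 0 < s) (f : ℕ → ℝ)
    (h1 : ∀ l, f l ≤ 4 * R * s * 2 ^ l) (h2 : ∀ l, f l ≤ 2)
    (h3 : ∀ l, f l ≤ 1 / (s * 2 ^ l)) (N : ℕ) :
    ∑ l ∈ Finset.range (N + 0), f l ≤ 4 * R * s * (2 ^ N - 1) ∧
    (∀ j, ∑ l ∈ Finset.range (N + j), f l ≤ 4 * R * s * (2 ^ N - 1) + 2 * j) ∧
    (∀ i, ∑ l ∈ Finset.range (N + i), f l ≤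
      ∑ l ∈ Finset.range N, f l + 2 / (s * 2 ^ N) - 2 / (s * 2 ^ (N + i))) := by
  have a : ∑ l ∈ Finset.range (N + 0), f l ≤ 4 * R * s * (2 ^ N - 1) := by
    induction N with
    | zero => simp
    | succ k ih =>
      simp only [add_zero] at ih ⊢
      rw [Finset.sum_range_succ, pow_succ]
      have := h1 k
      linarith
  refine ⟨a, ?_, ?_⟩
  · intro j
    induction j with
    | zero => simpa using a
    | succ k ih =>
      rw [← add_assoc, Finset.sum_range_succ]
      have := h2 (N + k)
      push_cast
      linarith
  · intro i
    induction i with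
    | zero => simp
    | succ k ih =>
      rw [← add_assoc, Finset.sum_range_succ]
      have := h3 (N + k)
      have e1 : 2 / (s * 2 ^ (N + k)) = 2 * (1 / (s * 2 ^ (N + k))) := by ring
      have e2 : 2 / (s * 2 ^ (N + k + 1)) = 1 / (s * 2 ^ (N + k)) := by
        rw [pow_succ]; field_simp
      rw [e2]; rw [e1] at ih
      linarith

lemma aux_log (r : ℝ) (h1 : 1 ≤ r) (h2 : r ≤ 2) : r - 1 ≤ Real.logb 2 r := by
  rw [Real.le_logb_iff_rpow_le (by norm_num) (by linarith)]
  have := rpow_one_add_le_one_add_mul_self (s := 1) (p := r - 1) (by norm_num)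
    (by linarith) (by linarith)
  norm_num at this
  exact this

lemma aux_main (R s : ℝ) (hR : 1 ≤ R) (hs : 0 < s) (f : ℕ → ℝ) (h0 : ∀ l, 0 ≤ f l)
    (h1 : ∀ l, f l ≤ 4 * R * s * 2 ^ l) (h2 : ∀ l, f l ≤ 2)
    (h3 : ∀ l, f l ≤ 1 / (s * 2 ^ l)) (N : ℕ) :
    ∑ l ∈ Finset.range N, f l ≤ 8 * (Real.logb 2 R + 1) := by
  obtain ⟨k, hk1, hk2⟩ := exists_nat_pow_near hR (by norm_num : (1 : ℝ) < 2)
  have hkp : (0 : ℝ) < 2 ^ k := by positivity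
  obtain ⟨r, hr⟩ : ∃ r, r = R / 2 ^ k := ⟨_, rfl⟩
  have hRr : R = 2 ^ k * r := by rw [hr]; field_simp
  have hr1 : 1 ≤ r := by rw [hr, le_div_iff₀ hkp]; linarith
  have hr2 : r ≤ 2 := by rw [hr, div_le_iff₀ hkp]; rw [pow_succ] at hk2; linarith
  have hlog : k + (r - 1) ≤ Real.logb 2 R := by
    rw [hRr, Real.logb_mul hkp.ne' (by linarith), Real.logb_pow,
      Real.logb_self_eq_one (by norm_num)]
    have := aux_log r hr1 hr2
    linarith
  have hex : ∃ n : ℕ, 1 / 2 ≤ s * 2 ^ n := by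
    obtain ⟨n, hn⟩ := pow_unbounded_of_one_lt (1 / 2 / s) (by norm_num : (1 : ℝ) < 2)
    refine ⟨n, ?_⟩
    rw [div_lt_iff₀ hs] at hn
    linarith
  classical
  obtain ⟨n, hn, hmin⟩ : ∃ n : ℕ, 1 / 2 ≤ s * 2 ^ n ∧ ∀ m < n, ¬ (1 / 2 ≤ s * 2 ^ m) :=
    ⟨Nat.find hex, Nat.find_spec hex, fun m hm => Nat.find_min hex hm⟩
  have hsum : ∑ l ∈ Finset.range N, f l ≤ ∑ l ∈ Finset.range (n + N), f l :=
    Finset.sum_le_sum_of_subset_of_nonneg (Finset.range_mono (by omega)) (fun i _ _ => h0 i)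
  have hT := (aux_sum R s hR hs f h1 h2 h3 n).2.2 N
  have hpos : 0 ≤ 2 / (s * 2 ^ (n + N)) := by positivity
  have hx4 : 2 / (s * 2 ^ n) ≤ 4 := by
    rw [div_le_iff₀ (by positivity)]; linarith
  have hk0 : (0 : ℝ) ≤ k := Nat.cast_nonneg k
  rcases le_or_gt n k with hnk | hnk
  · have hM := (aux_sum R s hR hs f h1 h2 h3 0).2.1 n
    simp only [zero_add, pow_zero, sub_self, mul_zero] at hM
    have : (n : ℝ) ≤ k := by exact_mod_cast hnk
    linarith
  · obtain ⟨m, rfl⟩ : ∃ m, n = m + k := ⟨n - k, by omega⟩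
    have hM := (aux_sum R s hR hs f h1 h2 h3 m).2.1 k
    have hlt := hmin (m + k - 1) (by omega)
    have hx1 : s * 2 ^ (m + k) ≤ 1 := by
      have e : m + k = (m + k - 1) + 1 := by omega
      rw [e, pow_succ]
      linarith
    have e : 4 * R * s * (2 ^ m - 1) ≤ 4 * r * (s * 2 ^ (m + k)) := by
      have : 4 * r * (s * 2 ^ (m + k)) = 4 * R * s * 2 ^ m := by
        rw [hRr, pow_add]; ring
      rw [this]
      have : 0 < 4 * R * s := by positivity
      linarith
    generalize s * 2 ^ (m + k) = x at *
    have hx : 2 / x ≤ 6 - 4 * x := by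
      rw [div_le_iff₀ (by linarith)]
      nlinarith
    nlinarith

/-- the weighted sum over tree levels of split probabilities, each
bounded both linearly and quadratically in `(2^{ℓ+1}-1)/d`, is at most
`8ξA(log₂(B/A + 1) + 1)`. -/
theorem stmt_10 (A B ξ d : ℝ) (hA : 0 < A) (hB : 0 ≤ B) (hξ : 0 < ξ) (hd : 0 < d)
    (L : ℕ) (p : ℕ → ℝ)
    (hp0 : ∀ ℓ ≤ L, 0 ≤ p ℓ) (hp1 : ∀ ℓ ≤ L, p ℓ ≤ 1)
    (hlin : ∀ ℓ ≤ L, p ℓ ≤ ((2 ^ (ℓ + 1) - 1) / d) * A)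
    (hquad : ∀ ℓ ≤ L, p ℓ ≤ ((2 ^ (ℓ + 1) - 1) / d) ^ 2 * A * (A + B)) :
    ∑ ℓ ∈ Finset.range (L + 1), p ℓ * (d * ξ / 2 ^ ℓ) ≤
      8 * ξ * A * (Real.logb 2 (B / A + 1) + 1) := by
  have hR : 1 ≤ B / A + 1 := by have := div_nonneg hB hA.le; linarith
  have hs : 0 < A / d := by positivity
  have key := aux_main (B / A + 1) (A / d) hR hs
    (fun l => if l ≤ L then p l * (d / (A * 2 ^ l)) else 0) ?_ ?_ ?_ ?_ (L + 1)
  · have e : ∑ ℓ ∈ Finset.range (L + 1), p ℓ * (d * ξ / 2 ^ ℓ) = (ξ * A) *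
        ∑ l ∈ Finset.range (L + 1), (if l ≤ L then p l * (d / (A * 2 ^ l)) else 0) := by
      rw [Finset.mul_sum]
      refine Finset.sum_congr rfl fun l hl => ?_
      rw [if_pos (by have := Finset.mem_range.mp hl; omega)]
      field_simp
    rw [e]
    have := mul_le_mul_of_nonneg_left key (mul_pos hξ hA).le
    linarith
  · intro l
    split_ifs with h
    · have := hp0 l h
      positivity
    · exact le_rfl
  · intro l
    split_ifs with h
    · have hb : ((2 ^ (l + 1) - 1) / d) ^ 2 * A * (A + B) ≤
          (2 ^ (l + 1) / d) ^ 2 * A * (A + B) := by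
        have h1 : (1 : ℝ) ≤ 2 ^ (l + 1) := one_le_pow₀ (by norm_num)
        have h2 : (0 : ℝ) ≤ 2 ^ (l + 1) - 1 := by linarith
        gcongr
        linarith
      calc p l * (d / (A * 2 ^ l)) ≤ (2 ^ (l + 1) / d) ^ 2 * A * (A + B) * (d / (A * 2 ^ l)) :=
            mul_le_mul_of_nonneg_right ((hquad l h).trans hb) (by positivity)
        _ = 4 * (B / A + 1) * (A / d) * 2 ^ l := by
            rw [pow_succ]; field_simp; ring
    · positivity
  · intro l
    split_ifs with h
    · have hb : ((2 ^ (l + 1) - 1) / d) * A ≤ (2 ^ (l + 1) / d) * A := by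
        gcongr
        linarith
      calc p l * (d / (A * 2 ^ l)) ≤ (2 ^ (l + 1) / d) * A * (d / (A * 2 ^ l)) :=
            mul_le_mul_of_nonneg_right ((hlin l h).trans hb) (by positivity)
        _ = 2 := by
            rw [pow_succ]; field_simp
    · norm_num
  · intro l
    split_ifs with h
    · calc p l * (d / (A * 2 ^ l)) ≤ 1 * (d / (A * 2 ^ l)) :=
            mul_le_mul_of_nonneg_right (hp1 l h) (by positivity)
        _ = 1 / (A / d * 2 ^ l) := by field_simp
    · positivity
end
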